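/- Let X be a complex Hilbert space, 0 < q1 ≤ q2 < 2, α > 1/q2, τ ≥ 0; set δ := 1/q1 − 1/q2 and β := (1/q1)·α/(α+δ). Let σ1 = (σ_{1,s})_{s∈ℕ}, σ2 = (σ_{2,s})_{s∈ℕ} be sequences of reals strictly greater than 1 with Σ_s σ_{1,s}^{-q1} ≤ 1 and Σ_s σ_{2,s}^{-q2} ≤ 1. Then there exists a constant C > 0 such that for every integer m ≥ 1 and every integer n ≥ 2 there exists a finite set Λ ⊂ ℕ with card Λ ≤ n, depending only on σ1, σ2, m, n and the parameters, such that every sequence w : ℕ → X satisfying Σ_s (σ_{1,s}‖w_s‖_X)² ≤ 1 and Σ_s (σ_{2,s}‖w_s‖_X)² ≤ (2^{-αm}·m^{τ})² obeys (Σ_{s∉Λ} ‖w_s‖_X²)^{1/2} ≤ C · (2^m n)^{-β} · (m + log n)^{βτ/α}. -/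

import Mathlib

open ENNReal

noncomputable section

/-- If `∑ σ_s^{-q} ≤ 1`, then all but at most `n` indices satisfy `σ_s⁻¹ ≤ n^{-1/q}`. -/
theorem exists_finset_card_le_inv_le {σ : ℕ → ℝ} {q : ℝ} (hq : 0 < q) (hσ : ∀ s, 1 < σ s)
    (hσq : (∑' s, ENNReal.ofReal (((σ s)⁻¹) ^ q)) ≤ 1) {n : ℕ} (hn : n ≠ 0) :
    ∃ Λ : Finset ℕ, Λ.card ≤ n ∧ ∀ s ∉ Λ, (σ s)⁻¹ ≤ (n : ℝ) ^ (-(1 / q)) := by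
  obtain ⟨hf, hcard⟩ := ENNReal.finset_card_const_le_le_of_tsum_le ENNReal.one_ne_top hσq
    (ε := (n : ℝ≥0∞)⁻¹) (by simp)
  refine ⟨hf.toFinset, ?_, fun s hs => ?_⟩
  · rw [one_div, inv_inv] at hcard
    exact_mod_cast hcard
  · have hσs : 0 ≤ (σ s)⁻¹ := inv_nonneg.2 (zero_le_one.trans (hσ s).le)
    have hlt : ENNReal.ofReal (((σ s)⁻¹) ^ q) < (n : ℝ≥0∞)⁻¹ := by simpa using hs
    have hn0 : (0 : ℝ) < n := by positivity
    have hle : ((σ s)⁻¹) ^ q ≤ (n : ℝ)⁻¹ := by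
      refine (ENNReal.ofReal_le_ofReal_iff (by positivity)).1 ?_
      rw [ENNReal.ofReal_inv_of_pos hn0, ENNReal.ofReal_natCast]
      exact hlt.le
    calc (σ s)⁻¹ = (((σ s)⁻¹) ^ q) ^ (1 / q) := by
          rw [← Real.rpow_mul hσs, mul_one_div_cancel hq.ne', Real.rpow_one]
      _ ≤ ((n : ℝ)⁻¹) ^ (1 / q) := by gcongr
      _ = (n : ℝ) ^ (-(1 / q)) := by rw [Real.inv_rpow hn0.le, Real.rpow_neg hn0.le]

/-- The `ℓ²` norm off `Λ` is at most `A * b` if the `σ`-weighted norm is at most `A` and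
`σ_s⁻¹ ≤ b` off `Λ`. -/
theorem tsum_notMem_rpow_half_le {X : Type*} [NormedAddCommGroup X] {σ : ℕ → ℝ} {A b : ℝ}
    (hσ : ∀ s, 1 < σ s) (hA : 0 ≤ A) (hb : 0 ≤ b) {Λ : Finset ℕ}
    (hΛ : ∀ s ∉ Λ, (σ s)⁻¹ ≤ b) {w : ℕ → X}
    (hw : (∑' s : ℕ, ENNReal.ofReal ((σ s * ‖w s‖) ^ 2)) ≤ ENNReal.ofReal (A ^ 2)) :
    (∑' s : ℕ, if s ∉ Λ then ENNReal.ofReal (‖w s‖ ^ 2) else 0) ^ (1 / 2 : ℝ)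
      ≤ ENNReal.ofReal (A * b) := by
  have hterm : ∀ s, (if s ∉ Λ then ENNReal.ofReal (‖w s‖ ^ 2) else 0) ≤
      ENNReal.ofReal (b ^ 2) * ENNReal.ofReal ((σ s * ‖w s‖) ^ 2) := by
    intro s
    by_cases hs : s ∈ Λ
    · simp [hs]
    · rw [if_pos hs, ← ENNReal.ofReal_mul (by positivity), ← mul_pow]
      have hσs : 0 < σ s := zero_lt_one.trans (hσ s)
      gcongr
      calc ‖w s‖ = (σ s)⁻¹ * (σ s * ‖w s‖) := by field_simp
        _ ≤ b * (σ s * ‖w s‖) := by gcongr; exact hΛ s hs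
  have hsum : (∑' s : ℕ, if s ∉ Λ then ENNReal.ofReal (‖w s‖ ^ 2) else 0) ≤
      ENNReal.ofReal ((A * b) ^ 2) := by
    refine (ENNReal.tsum_le_tsum hterm).trans ?_
    rw [ENNReal.tsum_mul_left, mul_pow, mul_comm (A ^ 2), ENNReal.ofReal_mul (by positivity)]
    gcongr
  refine (ENNReal.rpow_le_rpow hsum (by norm_num)).trans_eq ?_
  rw [ENNReal.ofReal_rpow_of_nonneg (by positivity) (by norm_num), ← Real.sqrt_eq_rpow,
    Real.sqrt_sq (by positivity)]

/-- The minimum of two nonnegative reals is at most any weighted geometric mean of them. -/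
theorem min_le_rpow_mul_rpow {x y θ : ℝ} (hx : 0 < x) (hy : 0 < y) (h0 : 0 ≤ θ) (h1 : θ ≤ 1) :
    min x y ≤ x ^ (1 - θ) * y ^ θ := by
  have hm : 0 < min x y := lt_min hx hy
  calc min x y = min x y ^ (1 - θ) * min x y ^ θ := by
        rw [← Real.rpow_add hm, sub_add_cancel, Real.rpow_one]
    _ ≤ x ^ (1 - θ) * y ^ θ := by
        have := sub_nonneg.2 h1
        gcongr
        · exact min_le_left x y
        · exact min_le_right x y

/-- Interpolation of the two truncation rates `n^{-1/q1}` and `2^{-αm} m^τ n^{-1/q2}`. -/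
theorem min_truncation_rates_le {q1 q2 α τ δ β : ℝ} (hq1 : 0 < q1) (hq12 : q1 ≤ q2)
    (hα : 1 / q2 < α) (hτ : 0 ≤ τ) (hδ : δ = 1 / q1 - 1 / q2)
    (hβ : β = (1 / q1) * (α / (α + δ))) {m n : ℕ} (hm : 1 ≤ m) (hn : 1 ≤ n) :
    min ((n : ℝ) ^ (-(1 / q1)))
        ((2 : ℝ) ^ (-(α * (m : ℝ))) * (m : ℝ) ^ τ * (n : ℝ) ^ (-(1 / q2))) ≤
      ((2 : ℝ) ^ (m : ℝ) * (n : ℝ)) ^ (-β) * ((m : ℝ) + Real.log n) ^ (β * τ / α) := by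
  have hq2 : 0 < q2 := hq1.trans_le hq12
  have hα0 : 0 < α := (one_div_pos.2 hq2).trans hα
  have hδ0 : 0 ≤ δ := by rw [hδ]; exact sub_nonneg.2 (one_div_le_one_div_of_le hq1 hq12)
  have hm0 : (0 : ℝ) < m := by exact_mod_cast hm
  have hn0 : (0 : ℝ) < n := by exact_mod_cast hn
  have hβ0 : 0 ≤ β := by rw [hβ]; positivity
  have hβα : (1 / q1) * (1 - β / α) + (1 / q2) * (β / α) = β := by
    have hq2δ : 1 / q2 = 1 / q1 - δ := by rw [hδ]; ring
    rw [hq2δ, hβ]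
    field_simp
    ring
  have hθ : β / α ≤ 1 := by
    have hθ_eq : β / α = (1 / q1) / (α + δ) := by rw [hβ]; field_simp
    rw [hθ_eq, div_le_one (by positivity), hδ]
    linarith
  refine (min_le_rpow_mul_rpow (by positivity) (by positivity) (by positivity) hθ).trans ?_
  have hlog : 0 ≤ Real.log n := Real.log_natCast_nonneg n
  have hrate : ((n : ℝ) ^ (-(1 / q1))) ^ (1 - β / α) *
      ((2 : ℝ) ^ (-(α * (m : ℝ))) * (m : ℝ) ^ τ * (n : ℝ) ^ (-(1 / q2))) ^ (β / α) =
      ((2 : ℝ) ^ (m : ℝ) * (n : ℝ)) ^ (-β) * (m : ℝ) ^ (β * τ / α) := by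
    rw [Real.mul_rpow (by positivity) (by positivity),
      Real.mul_rpow (by positivity) (by positivity),
      Real.mul_rpow (by positivity) (by positivity), ← Real.rpow_mul hn0.le,
      ← Real.rpow_mul hn0.le, ← Real.rpow_mul hm0.le, ← Real.rpow_mul zero_le_two,
      ← Real.rpow_mul zero_le_two]
    have hn_exp : (n : ℝ) ^ (-β) =
        (n : ℝ) ^ (-(1 / q1) * (1 - β / α)) * (n : ℝ) ^ (-(1 / q2) * (β / α)) := by
      rw [← Real.rpow_add hn0]
      congr 1
      linarith
    have hexp_two : -(α * (m : ℝ)) * (β / α) = m * -β := by field_simp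
    have hexp_m : τ * (β / α) = β * τ / α := by ring
    rw [hn_exp, hexp_two, hexp_m]
    ring
  rw [hrate]
  gcongr
  linarith

/-- truncation of coefficient sequences satisfying a two-weight constraint.
There is `C > 0` such that for every `m ≥ 1` and `n ≥ 2` there is a set `Λ ⊂ ℕ` of
cardinality `≤ n` (depending only on the weights and the parameters) such that every
`w : ℕ → X` with `Σ_s (σ_{1,s}‖w_s‖)² ≤ 1` and `Σ_s (σ_{2,s}‖w_s‖)² ≤ (2^{-αm} m^τ)²`
satisfies `(Σ_{s ∉ Λ} ‖w_s‖²)^{1/2} ≤ C·(2^m n)^{-β}·(m + log n)^{βτ/α}`. -/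
theorem statement9
    {X : Type*} [NormedAddCommGroup X] [InnerProductSpace ℂ X]
    (q1 q2 α τ : ℝ) (hq1 : 0 < q1) (hq12 : q1 ≤ q2) (hq2 : q2 < 2)
    (hα : 1 / q2 < α) (hτ : 0 ≤ τ)
    (δ β : ℝ) (hδ : δ = 1 / q1 - 1 / q2) (hβ : β = (1 / q1) * (α / (α + δ)))
    (σ1 σ2 : ℕ → ℝ) (hσ1 : ∀ s, 1 < σ1 s) (hσ2 : ∀ s, 1 < σ2 s)
    (hσ1q : (∑' s, ENNReal.ofReal (((σ1 s)⁻¹) ^ q1)) ≤ 1)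
    (hσ2q : (∑' s, ENNReal.ofReal (((σ2 s)⁻¹) ^ q2)) ≤ 1) :
    ∃ C : ℝ, 0 < C ∧
      ∀ (m : ℕ), 1 ≤ m → ∀ (n : ℕ), 2 ≤ n →
        ∃ Λ : Finset ℕ, Λ.card ≤ n ∧
          ∀ w : ℕ → X,
            (∑' s : ℕ, ENNReal.ofReal ((σ1 s * ‖w s‖) ^ 2)) ≤ 1 →
            (∑' s : ℕ, ENNReal.ofReal ((σ2 s * ‖w s‖) ^ 2))
              ≤ ENNReal.ofReal (((2 : ℝ) ^ (-(α * (m : ℝ))) * (m : ℝ) ^ τ) ^ 2) →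
            (∑' s : ℕ, if s ∉ Λ then ENNReal.ofReal (‖w s‖ ^ 2) else 0) ^ (1 / 2 : ℝ)
              ≤ ENNReal.ofReal
                  (C * ((2 : ℝ) ^ (m : ℝ) * (n : ℝ)) ^ (-β) *
                    ((m : ℝ) + Real.log n) ^ (β * τ / α)) := by
  refine ⟨1, one_pos, fun m hm n hn => ?_⟩
  have hn0 : n ≠ 0 := by omega
  have hrate := min_truncation_rates_le hq1 hq12 hα hτ hδ hβ hm (one_le_two.trans hn)
  rw [one_mul]
  rcases min_le_iff.1 hrate with h | h
  · obtain ⟨Λ, hcard, hΛ⟩ := exists_finset_card_le_inv_le hq1 hσ1 hσ1q hn0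
    refine ⟨Λ, hcard, fun w hw _ => ?_⟩
    refine (tsum_notMem_rpow_half_le hσ1 zero_le_one (by positivity) hΛ (by simpa using hw)).trans
      (ENNReal.ofReal_le_ofReal ?_)
    rwa [one_mul]
  · obtain ⟨Λ, hcard, hΛ⟩ := exists_finset_card_le_inv_le (hq1.trans_le hq12) hσ2 hσ2q hn0
    exact ⟨Λ, hcard, fun w _ hw => (tsum_notMem_rpow_half_le hσ2 (by positivity) (by positivity)
      hΛ hw).trans (ENNReal.ofReal_le_ofReal h)⟩

end
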